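/- arXiv:2207.07944 — 3 statements merged into one kernel-verified Lean document; each statement's English description precedes it below -/
import Mathlib

section
/- Let D ≥ 2 and r > 0. Let Λ be a unimodular lattice in ℝ^D such that every nonzero vector φ of the dual lattice Λ* satisfies ‖φ‖ ≥ r. Then there exists a constant c' > 0 depending only on D such that for any two linearly independent vectors v, w ∈ Λ one has ‖v ∧ w‖ ≥ c' · r^{D-2}. -/
open scoped BigOperators

/-- The lattice in `ℝ^D` spanned over `ℤ` by the columns of the matrix `g`. -/
noncomputable def lat {D : ℕ} (g : Matrix (Fin D) (Fin D) ℝ) :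
    Set (EuclideanSpace ℝ (Fin D)) :=
  {v | ∃ m : Fin D → ℤ, ∀ i, v i = ∑ j, g i j * (m j : ℝ)}

/-- The dual lattice, identified with a subset of `ℝ^D` via the inner product. -/
def dualLat {D : ℕ} (L : Set (EuclideanSpace ℝ (Fin D))) :
    Set (EuclideanSpace ℝ (Fin D)) :=
  {u | ∀ v ∈ L, ∃ k : ℤ, (k : ℝ) = ∑ i, u i * v i}

open Matrix MeasureTheory in
theorem linForms {n : ℕ} (B : Matrix (Fin n) (Fin n) ℝ) (hB : B.det ≠ 0) (c : Fin n → ℝ)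
    (hc : ∀ i, 0 < c i) (h : |B.det| < ∏ i, c i) :
    ∃ k : Fin n → ℤ, k ≠ 0 ∧ ∀ i, |∑ j, B i j * (k j : ℝ)| < c i := by
  set b := Pi.basisFun ℝ (Fin n)
  let s : Set (Fin n → ℝ) := (Matrix.toLin' B) ⁻¹' (Set.pi Set.univ fun i => Set.Ioo (-c i) (c i))
  have hdet : LinearMap.det (Matrix.toLin' B) = B.det := LinearMap.det_toLin' B
  have hvol : volume s = ENNReal.ofReal |B.det⁻¹| * ∏ i, ENNReal.ofReal (2 * c i) := by
    have := Measure.addHaar_preimage_linearMap (volume : Measure (Fin n → ℝ))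
      (f := Matrix.toLin' B) (by rw [hdet]; exact hB)
      (Set.pi Set.univ fun i => Set.Ioo (-c i) (c i))
    rw [hdet] at this
    rw [this, Real.volume_pi_Ioo]
    congr 1
    refine Finset.prod_congr rfl fun i _ => ?_
    congr 1; ring
  have hsymm : ∀ x ∈ s, -x ∈ s := by
    intro x hx
    simp only [s, Set.mem_preimage, Set.mem_univ_pi, Set.mem_Ioo, map_neg, Pi.neg_apply] at hx ⊢
    intro i
    have := hx i
    constructor <;> linarith
  have hconv : Convex ℝ s :=
    (convex_pi fun i _ => convex_Ioo _ _).linear_preimage (Matrix.toLin' B)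
  have fund := ZSpan.isAddFundamentalDomain b (volume : Measure (Fin n → ℝ))
  have hF : volume (ZSpan.fundamentalDomain b) = 1 := by
    rw [ZSpan.fundamentalDomain_pi_basisFun, volume_pi_pi]; simp
  have hlt : volume (ZSpan.fundamentalDomain b) * 2 ^ Module.finrank ℝ (Fin n → ℝ) < volume s := by
    rw [hF, hvol, ← ENNReal.ofReal_prod_of_nonneg (fun i _ => by have := hc i; positivity),
      ← ENNReal.ofReal_mul (abs_nonneg _), one_mul, Module.finrank_fin_fun, Finset.prod_mul_distrib]
    have h2 : (2 : ENNReal) ^ n = ENNReal.ofReal (2 ^ n) := by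
      rw [ENNReal.ofReal_pow (by norm_num)]; norm_num
    rw [h2, ENNReal.ofReal_lt_ofReal_iff_of_nonneg (by positivity)]
    have hp : 0 < |B.det| := abs_pos.mpr hB
    rw [abs_inv, inv_mul_eq_div, lt_div_iff₀ hp]
    simp only [Finset.prod_const, Finset.card_univ, Fintype.card_fin]
    exact mul_lt_mul_of_pos_left h (by positivity)
  haveI : Countable (Submodule.span ℤ (Set.range b)).toAddSubgroup :=
    inferInstanceAs (Countable (Submodule.span ℤ (Set.range b)))
  obtain ⟨x, hx0, hxs⟩ := exists_ne_zero_mem_lattice_of_measure_mul_two_pow_lt_measure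
    (L := (Submodule.span ℤ (Set.range b)).toAddSubgroup) fund hsymm hconv hlt
  have hmem := (b.mem_span_iff_repr_mem ℤ (x : Fin n → ℝ)).1 x.2
  choose k hk using hmem
  have hk' : ∀ i, (k i : ℝ) = (x : Fin n → ℝ) i := by
    intro i
    have := hk i
    simpa [b] using this
  refine ⟨k, ?_, ?_⟩
  · intro h0
    apply hx0
    ext i
    rw [← hk' i, h0]; simp
  · intro i
    simp only [s, Set.mem_preimage, Set.mem_univ_pi, Set.mem_Ioo] at hxs
    have := hxs i
    rw [Matrix.toLin'_apply] at this
    simp only [Matrix.mulVec, dotProduct, ← hk'] at this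
    exact abs_lt.mpr this

open Matrix in
theorem exists_frame {n : ℕ} (v w : EuclideanSpace ℝ (Fin (n + 2)))
    (h : LinearIndependent ℝ ![v, w]) :
    ∃ (A : Matrix (Fin (n + 2)) (Fin (n + 2)) ℝ) (e : Fin (n + 2) ≃ Fin 2 ⊕ Fin n),
      A.det ≠ 0 ∧ A.det ^ 2 = ‖v‖ ^ 2 * ‖w‖ ^ 2 - (∑ i, v i * w i) ^ 2 ∧
      (∀ j, A (e.symm (Sum.inl 0)) j = v j) ∧ (∀ j, A (e.symm (Sum.inl 1)) j = w j) ∧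
      (∀ u : EuclideanSpace ℝ (Fin (n + 2)), ∑ i, u i * v i = 0 → ∑ i, u i * w i = 0 →
        ‖u‖ ^ 2 = ∑ t : Fin n, (∑ j, A (e.symm (Sum.inr t)) j * u j) ^ 2) := by
  have hinner : ∀ x y : EuclideanSpace ℝ (Fin (n + 2)), inner ℝ x y = ∑ i, x i * y i := by
    intro x y
    simp [PiLp.inner_apply, mul_comm]
  set P : Submodule ℝ (EuclideanSpace ℝ (Fin (n + 2))) := Submodule.span ℝ (Set.range ![v, w])
  have hP : Module.finrank ℝ P = 2 := by
    simpa using finrank_span_eq_card h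
  have hPo : Module.finrank ℝ Pᗮ = n := by
    have := P.finrank_add_finrank_orthogonal
    rw [hP, finrank_euclideanSpace_fin] at this
    omega
  let f : OrthonormalBasis (Fin n) ℝ Pᗮ := (stdOrthonormalBasis ℝ Pᗮ).reindex (finCongr hPo)
  have hvP : v ∈ P := Submodule.subset_span ⟨0, rfl⟩
  have hwP : w ∈ P := Submodule.subset_span ⟨1, rfl⟩
  let R : Fin 2 ⊕ Fin n → EuclideanSpace ℝ (Fin (n + 2)) :=
    Sum.elim ![v, w] (fun t => (f t : EuclideanSpace ℝ (Fin (n + 2))))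
  let e : Fin (n + 2) ≃ Fin 2 ⊕ Fin n := (finCongr (Nat.add_comm n 2)).trans finSumFinEquiv.symm
  let A : Matrix (Fin (n + 2)) (Fin (n + 2)) ℝ := Matrix.of fun i j => R (e i) j
  have hdet : A.det ^ 2 = ‖v‖ ^ 2 * ‖w‖ ^ 2 - (∑ i, v i * w i) ^ 2 := by
    have h1 : A * Aᵀ = (Matrix.fromBlocks
        !![inner ℝ v v, inner ℝ v w; inner ℝ w v, inner ℝ w w] 0 0
        (1 : Matrix (Fin n) (Fin n) ℝ)).submatrix e e := by
      ext i j
      have h2 : (A * Aᵀ) i j = inner ℝ (R (e i)) (R (e j)) := by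
        rw [hinner]; simp [Matrix.mul_apply, A]
      rw [h2, Matrix.submatrix_apply]
      have ho : ∀ t, inner ℝ v (f t : EuclideanSpace ℝ (Fin (n + 2))) = 0 :=
        fun t => (f t).2 v hvP
      have ho' : ∀ t, inner ℝ w (f t : EuclideanSpace ℝ (Fin (n + 2))) = 0 :=
        fun t => (f t).2 w hwP
      rcases e i with a | a <;> rcases e j with b | b
      · fin_cases a <;> fin_cases b <;> simp [R]
      · fin_cases a <;> simp [R, ho, ho']
      · fin_cases b
        · simp [R]; rw [real_inner_comm]; exact ho a
        · simp [R]; rw [real_inner_comm]; exact ho' a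
      · have := (orthonormal_iff_ite.1 f.orthonormal) a b
        simp only [R, Sum.elim_inr, Matrix.fromBlocks_apply₂₂, Matrix.one_apply]
        rw [← this]; rfl
    have h3 := congrArg Matrix.det h1
    rw [Matrix.det_mul, Matrix.det_transpose, Matrix.det_submatrix_equiv_self,
      Matrix.det_fromBlocks_zero₂₁, Matrix.det_one, Matrix.det_fin_two_of, real_inner_comm v w,
      real_inner_self_eq_norm_sq, real_inner_self_eq_norm_sq, hinner v w] at h3
    linarith
  refine ⟨A, e, ?_, hdet, ?_, ?_, ?_⟩
  · intro h0
    rw [h0] at hdet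
    have h4 : (inner ℝ v w : ℝ) ^ 2 = (‖v‖ * ‖w‖) ^ 2 := by rw [hinner]; linarith
    have h5 : |inner ℝ v w| = ‖v‖ * ‖w‖ := by
      rw [← abs_of_nonneg (by positivity : 0 ≤ ‖v‖ * ‖w‖)]
      exact (sq_eq_sq_iff_abs_eq_abs _ _).1 h4
    have hv0 : v ≠ 0 := h.ne_zero 0
    have h6 := ((abs_real_inner_div_norm_mul_norm_eq_one_iff v w).1 (by
      have hw0 : w ≠ 0 := h.ne_zero 1
      rw [abs_div, h5, abs_of_nonneg (by positivity)]
      exact div_self (by simp [hv0, hw0]))).2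
    obtain ⟨a, _, ha⟩ := h6
    have := (LinearIndependent.pair_iff.1 h) a (-1) (by rw [ha]; simp)
    norm_num at this
  · intro j; simp [A, R]
  · intro j; simp [A, R]
  · intro u hu hu'
    have huP : u ∈ Pᗮ := by
      rw [Submodule.mem_orthogonal]
      intro x hx
      induction hx using Submodule.span_induction with
      | mem x hx =>
        obtain ⟨i, rfl⟩ := hx
        rw [real_inner_comm]
        fin_cases i
        · simpa [hinner] using hu
        · simpa [hinner] using hu'
      | zero => simp
      | add x y _ _ hx hy => rw [inner_add_left, hx, hy, add_zero]
      | smul a x _ hx => rw [inner_smul_left, hx, mul_zero]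
    have := f.sum_sq_norm_inner_right ⟨u, huP⟩
    have h7 : ‖(⟨u, huP⟩ : Pᗮ)‖ = ‖u‖ := rfl
    rw [h7] at this
    rw [← this]
    refine Finset.sum_congr rfl fun t _ => ?_
    rw [Submodule.coe_inner, hinner, Real.norm_eq_abs, sq_abs]
    simp [A, R]

/-- for a unimodular lattice whose dual has minimal norm at least `r`,
any two linearly independent lattice vectors `v, w` satisfy `‖v ∧ w‖ ≥ c' r^(D-2)`,
where `‖v ∧ w‖` is the area of the parallelogram spanned by `v` and `w`. -/
theorem stmt0 (D : ℕ) (hD : 2 ≤ D) :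
    ∃ c' : ℝ, 0 < c' ∧
      ∀ r : ℝ, 0 < r →
      ∀ g : Matrix (Fin D) (Fin D) ℝ, |g.det| = 1 →
      (∀ u ∈ dualLat (lat g), u ≠ 0 → r ≤ ‖u‖) →
      ∀ v w : EuclideanSpace ℝ (Fin D), v ∈ lat g → w ∈ lat g →
        LinearIndependent ℝ ![v, w] →
        c' * r ^ (D - 2) ≤
          Real.sqrt (‖v‖ ^ 2 * ‖w‖ ^ 2 - (∑ i, v i * w i) ^ 2) := by
  obtain ⟨n, rfl⟩ : ∃ n, D = n + 2 := ⟨D - 2, by omega⟩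
  refine ⟨(1 / ((n : ℝ) + 1)) ^ n, by positivity, ?_⟩
  intro r hr g hg hdual v w hv hw hli
  simp only [Nat.add_sub_cancel]
  by_contra hcon
  push Not at hcon
  obtain ⟨A, e, hA0, hA2, hAv, hAw, hAu⟩ := exists_frame v w hli
  rw [← hA2, Real.sqrt_sq_eq_abs, ← mul_pow] at hcon
  have hg0 : g.det ≠ 0 := by intro h0; rw [h0] at hg; norm_num at hg
  have hgu : IsUnit g.det := isUnit_iff_ne_zero.2 hg0
  set H := (g⁻¹).transpose with hH
  have hHdet : |H.det| = 1 := by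
    rw [hH, Matrix.det_transpose, Matrix.det_nonsing_inv, Ring.inverse_eq_inv', abs_inv, hg, inv_one]
  have hBdet : |(A * H).det| = |A.det| := by rw [Matrix.det_mul, abs_mul, hHdet, mul_one]
  let c : Fin (n + 2) → ℝ := fun i => Sum.elim (fun _ => 1) (fun _ => 1 / ((n : ℝ) + 1) * r) (e i)
  have hc : ∀ i, 0 < c i := by
    intro i
    simp only [c]
    rcases e i with a | a
    · simp
    · simp only [Sum.elim_inr]; positivity
  have hprod : ∏ i, c i = (1 / ((n : ℝ) + 1) * r) ^ n := by
    simp only [c]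
    rw [Equiv.prod_comp e (fun x => Sum.elim (fun _ => (1 : ℝ)) (fun _ => 1 / ((n : ℝ) + 1) * r) x),
      Fintype.prod_sum_type]
    simp
  obtain ⟨k, hk0, hk⟩ := linForms (A * H) (by
    rw [← abs_pos, hBdet]; exact abs_pos.2 hA0) c hc (by rw [hBdet, hprod]; exact hcon)
  let kr : Fin (n + 2) → ℝ := fun j => (k j : ℝ)
  let u : EuclideanSpace ℝ (Fin (n + 2)) := WithLp.toLp 2 (H.mulVec kr)
  have hku : ∀ i, ∑ j, (A * H) i j * (k j : ℝ) = ∑ j, A i j * u j := by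
    intro i
    change (A * H).mulVec kr i = A.mulVec (H.mulVec kr) i
    rw [Matrix.mulVec_mulVec]
  have hdu : u ∈ dualLat (lat g) := by
    rintro x ⟨m, hm⟩
    refine ⟨∑ j, k j * m j, ?_⟩
    have hx : (fun i => x i) = g.mulVec (fun j => (m j : ℝ)) := funext hm
    change _ = H.mulVec kr ⬝ᵥ (fun i => x i)
    rw [hx, hH, Matrix.mulVec_transpose, ← Matrix.dotProduct_mulVec, Matrix.mulVec_mulVec,
      Matrix.nonsing_inv_mul _ hgu, Matrix.one_mulVec]
    simp [dotProduct, kr]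
  have hu0 : u ≠ 0 := by
    intro h0
    have h1 : H.mulVec kr = 0 := by
      have := congrArg (WithLp.ofLp) h0
      simpa [u] using this
    have h2 := Matrix.eq_zero_of_mulVec_eq_zero (M := H) (by
      intro h; rw [h] at hHdet; norm_num at hHdet) h1
    apply hk0
    ext j
    have := congrFun h2 j
    simpa [kr] using this
  have hint : ∀ x ∈ lat g, |∑ i, u i * x i| < 1 → ∑ i, u i * x i = 0 := by
    intro x hx hlt
    obtain ⟨z, hz⟩ := hdu x hx
    rw [← hz] at hlt ⊢
    have : |z| < 1 := by exact_mod_cast hlt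
    rw [Int.abs_lt_one_iff.1 this]; simp
  have huv : ∑ i, u i * v i = 0 := by
    apply hint v hv
    have := hk (e.symm (Sum.inl 0))
    rw [hku] at this
    simpa [c, hAv, mul_comm] using this
  have huw : ∑ i, u i * w i = 0 := by
    apply hint w hw
    have := hk (e.symm (Sum.inl 1))
    rw [hku] at this
    simpa [c, hAw, mul_comm] using this
  have hnorm := hAu u huv huw
  have hle : ‖u‖ ^ 2 ≤ n * (1 / ((n : ℝ) + 1) * r) ^ 2 := by
    rw [hnorm]
    calc _ ≤ ∑ t : Fin n, (1 / ((n : ℝ) + 1) * r) ^ 2 := by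
          refine Finset.sum_le_sum fun t _ => ?_
          have := hk (e.symm (Sum.inr t))
          rw [hku] at this
          have h3 : c (e.symm (Sum.inr t)) = 1 / ((n : ℝ) + 1) * r := by simp [c]
          rw [h3] at this
          exact sq_le_sq' (abs_lt.1 this).1.le (abs_lt.1 this).2.le
      _ = _ := by simp
  have hru : r ^ 2 ≤ ‖u‖ ^ 2 := pow_le_pow_left₀ hr.le (hdual u hdu hu0) 2
  have h4 : (n : ℝ) * (1 / ((n : ℝ) + 1) * r) ^ 2 < r ^ 2 := by
    have hn : (0 : ℝ) ≤ n := Nat.cast_nonneg n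
    have : (n : ℝ) * (1 / ((n : ℝ) + 1) * r) ^ 2 = (n / ((n : ℝ) + 1) ^ 2) * r ^ 2 := by
      field_simp
    rw [this]
    have h5 : (n / ((n : ℝ) + 1) ^ 2) < 1 := by
      rw [div_lt_one (by positivity)]; nlinarith
    nlinarith [pow_pos hr 2]
  linarith
end

section
/- Let D ≥ 1, let Λ be a lattice in ℝ^D, and let K be a bounded centrally symmetric convex subset of ℝ^D with nonempty interior. Then the number of lattice points of Λ in the interior K°, in K, and in the closure of K are all comparable up to multiplicative constants depending only on D: #(K° ∩ Λ) ≍_D #(K ∩ Λ) ≍_D #(cl(K) ∩ Λ). -/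
open scoped BigOperators

open scoped BigOperators

lemma finite_aux {D : ℕ} (g : Matrix (Fin D) (Fin D) ℝ) (hg : g.det ≠ 0)
    (K : Set (EuclideanSpace ℝ (Fin D))) (hK : Bornology.IsBounded K) :
    (closure K ∩ lat g).Finite := by
  have hc : IsCompact (closure K) := hK.isCompact_closure
  have hcont : Continuous (fun v : EuclideanSpace ℝ (Fin D) => g⁻¹.mulVec (fun i => v i)) := by
    apply Continuous.matrix_mulVec <;> fun_prop
  obtain ⟨R, hR⟩ := (hc.image hcont).isBounded.exists_norm_le
  let f : (Fin D → ℤ) → EuclideanSpace ℝ (Fin D) :=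
    fun m => WithLp.toLp 2 (g.mulVec (fun j => (m j : ℝ)))
  apply ((Set.finite_Icc (fun _ : Fin D => -⌈R⌉) (fun _ : Fin D => ⌈R⌉)).image f).subset
  rintro v ⟨hv, m, hm⟩
  have hvm : (fun i => v i) = g.mulVec (fun j => (m j : ℝ)) := by
    ext i
    simp [hm i, Matrix.mulVec, dotProduct]
  refine ⟨m, ?_, ?_⟩
  · have h1 := hR _ ⟨v, hv, rfl⟩
    simp only [hvm, Matrix.mulVec_mulVec, Matrix.nonsing_inv_mul g (Ne.isUnit hg),
      Matrix.one_mulVec] at h1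
    have h2 : ∀ j, |(m j : ℝ)| ≤ R := fun j => by
      simpa using (norm_le_pi_norm (fun j => (m j : ℝ)) j).trans h1
    constructor
    · intro j
      have := (abs_le.1 (h2 j)).1
      have h3 : (-⌈R⌉ : ℝ) ≤ (m j : ℝ) := by linarith [Int.le_ceil R]
      exact_mod_cast h3
    · intro j
      have := (abs_le.1 (h2 j)).2
      have h3 : (m j : ℝ) ≤ (⌈R⌉ : ℝ) := by linarith [Int.le_ceil R]
      exact_mod_cast h3
  · ext i
    exact (congrFun hvm i).symm

lemma zero_mem_aux {D : ℕ} (K : Set (EuclideanSpace ℝ (Fin D))) (hs : K = -K)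
    (hc : Convex ℝ K) (hi : (interior K).Nonempty) : (0 : EuclideanSpace ℝ (Fin D)) ∈ interior K := by
  obtain ⟨x, hx⟩ := hi
  have hx' : -x ∈ K := by
    rw [hs]; simpa using interior_subset hx
  have := hc.combo_interior_closure_mem_interior hx (subset_closure hx')
    (a := 1/2) (b := 1/2) (by norm_num) (by norm_num) (by norm_num)
  simpa using this

lemma third_mem_aux {D : ℕ} (K : Set (EuclideanSpace ℝ (Fin D))) (hs : K = -K)
    (hc : Convex ℝ K) (hi : (interior K).Nonempty) {x y : EuclideanSpace ℝ (Fin D)}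
    (hx : x ∈ closure K) (hy : y ∈ closure K) : (1/3 : ℝ) • (x - y) ∈ interior K := by
  have h0 := zero_mem_aux K hs hc hi
  have hy' : -y ∈ closure K := by
    have h : -y ∈ -closure K := by simpa using hy
    rw [neg_closure, ← hs] at h
    exact h
  have hmid := hc.closure hx hy' (a := 1/2) (b := 1/2) (by norm_num) (by norm_num) (by norm_num)
  have := hc.combo_interior_closure_mem_interior h0 hmid
    (a := 1/3) (b := 2/3) (by norm_num) (by norm_num) (by norm_num)
  convert this using 1
  module

lemma card_aux {D : ℕ} (g : Matrix (Fin D) (Fin D) ℝ) (hg : g.det ≠ 0)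
    (K : Set (EuclideanSpace ℝ (Fin D))) (hK : Bornology.IsBounded K) (hs : K = -K)
    (hc : Convex ℝ K) (hi : (interior K).Nonempty) :
    (closure K ∩ lat g).ncard ≤ 3 ^ D * (interior K ∩ lat g).ncard := by
  classical
  have hfin := finite_aux g hg K hK
  have hfin' : (interior K ∩ lat g).Finite := hfin.subset
    (Set.inter_subset_inter_left _ (interior_subset.trans subset_closure))
  have hex : ∀ v : EuclideanSpace ℝ (Fin D), ∃ m : Fin D → ℤ,
      v ∈ lat g → ∀ i, v i = ∑ j, g i j * (m j : ℝ) := by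
    intro v
    by_cases h : v ∈ lat g
    · obtain ⟨m, hm⟩ := h
      exact ⟨m, fun _ => hm⟩
    · exact ⟨0, fun h' => absurd h' h⟩
  choose M hM using hex
  let f : EuclideanSpace ℝ (Fin D) → (Fin D → ZMod 3) := fun v j => (M v j : ZMod 3)
  rw [Set.ncard_eq_toFinset_card _ hfin, Set.ncard_eq_toFinset_card _ hfin']
  have key := Finset.card_le_mul_card_image_of_maps_to (f := f) (s := hfin.toFinset)
    (t := Finset.univ) (fun _ _ => Finset.mem_univ _) hfin'.toFinset.card ?_
  · rw [mul_comm]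
    simpa [ZMod.card] using key
  · intro c _
    rcases (hfin.toFinset.filter (fun v => f v = c)).eq_empty_or_nonempty with h | ⟨y, hy⟩
    · simp [h]
    · apply Finset.card_le_card_of_injOn (fun x => (1/3 : ℝ) • (x - y))
      · intro x hx
        simp only [Finset.coe_filter, Set.Finite.mem_toFinset, Set.mem_setOf_eq,
          Finset.mem_filter] at hx hy
        simp only [Set.Finite.coe_toFinset]
        obtain ⟨⟨hxK, hxl⟩, hxc⟩ := hx
        obtain ⟨⟨hyK, hyl⟩, hyc⟩ := hy
        refine ⟨third_mem_aux K hs hc hi hxK hyK, ?_⟩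
        have hd : ∀ j, ∃ k : ℤ, M x j - M y j = 3 * k := by
          intro j
          have h1 : (M y j : ZMod 3) = (M x j : ZMod 3) := congrFun (hyc.trans hxc.symm) j
          have := (ZMod.intCast_eq_intCast_iff_dvd_sub _ _ 3).1 h1
          exact_mod_cast this
        choose k hk using hd
        refine ⟨k, fun i => ?_⟩
        simp only [PiLp.smul_apply, PiLp.sub_apply, smul_eq_mul]
        rw [hM x hxl i, hM y hyl i, ← Finset.sum_sub_distrib, Finset.mul_sum]
        refine Finset.sum_congr rfl fun j _ => ?_
        have : (M x j : ℝ) - M y j = 3 * k j := by exact_mod_cast hk j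
        linear_combination (1/3 * g i j) * this
      · intro a _ b _ hab
        have := smul_right_injective _ (by norm_num : (1/3 : ℝ) ≠ 0) hab
        simpa using this

/-- for a bounded centrally symmetric convex body `K` with nonempty interior
and a lattice `Λ`, the counts of lattice points in the interior, in `K`, and in the
closure are all comparable up to constants depending only on `D`. -/
theorem stmt2 (D : ℕ) (hD : 1 ≤ D) :
    ∃ c₁ c₂ : ℝ, 0 < c₁ ∧ 0 < c₂ ∧
      ∀ g : Matrix (Fin D) (Fin D) ℝ, g.det ≠ 0 →
      ∀ K : Set (EuclideanSpace ℝ (Fin D)),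
        Bornology.IsBounded K → K = -K → Convex ℝ K → (interior K).Nonempty →
        (c₁ * ((K ∩ lat g).ncard : ℝ) ≤ ((interior K ∩ lat g).ncard : ℝ) ∧
          ((interior K ∩ lat g).ncard : ℝ) ≤ c₂ * ((K ∩ lat g).ncard : ℝ)) ∧
        (c₁ * ((K ∩ lat g).ncard : ℝ) ≤ ((closure K ∩ lat g).ncard : ℝ) ∧
          ((closure K ∩ lat g).ncard : ℝ) ≤ c₂ * ((K ∩ lat g).ncard : ℝ)) := by
  refine ⟨(3 ^ D)⁻¹, 3 ^ D, by positivity, by positivity, ?_⟩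
  intro g hg K hK hs hc hi
  have hfin := finite_aux g hg K hK
  have hIK : (interior K ∩ lat g).ncard ≤ (K ∩ lat g).ncard :=
    Set.ncard_le_ncard (Set.inter_subset_inter_left _ interior_subset)
      (hfin.subset (Set.inter_subset_inter_left _ subset_closure))
  have hKC : (K ∩ lat g).ncard ≤ (closure K ∩ lat g).ncard :=
    Set.ncard_le_ncard (Set.inter_subset_inter_left _ subset_closure) hfin
  have hCI := card_aux g hg K hK hs hc hi
  have h1 : ((interior K ∩ lat g).ncard : ℝ) ≤ (K ∩ lat g).ncard := by exact_mod_cast hIK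
  have h2 : ((K ∩ lat g).ncard : ℝ) ≤ (closure K ∩ lat g).ncard := by exact_mod_cast hKC
  have h3 : ((closure K ∩ lat g).ncard : ℝ) ≤ 3 ^ D * (interior K ∩ lat g).ncard := by
    exact_mod_cast hCI
  have hp : (1 : ℝ) ≤ 3 ^ D := one_le_pow₀ (by norm_num)
  have hpos : (0 : ℝ) < 3 ^ D := by positivity
  have hn : (0 : ℝ) ≤ (K ∩ lat g).ncard := Nat.cast_nonneg _
  have hself : ((K ∩ lat g).ncard : ℝ) ≤ 3 ^ D * (K ∩ lat g).ncard :=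
    le_mul_of_one_le_left hn hp
  refine ⟨⟨?_, h1.trans hself⟩, ?_, h3.trans (mul_le_mul_of_nonneg_left h1 hpos.le)⟩
  · rw [inv_mul_le_iff₀ hpos]
    exact h2.trans h3
  · rw [inv_mul_le_iff₀ hpos]
    exact hself.trans (mul_le_mul_of_nonneg_left h2 hpos.le)
end

section
/- Let D ≥ 2, let K ⊂ ℝ^D be a bounded centrally symmetric convex subset with nonempty interior, and let φ be a nonzero linear functional on ℝ^D with kernel H_φ. Then vol_{H_φ}(K ∩ H_φ) ≍_D ‖φ‖ · vol(K) / ‖φ‖_K, where ‖φ‖ is the Euclidean norm of φ, ‖φ‖_K = sup_{v∈K}|φ(v)|, and vol_{H_φ} is the (D−1)-dimensional Lebesgue measure on the hyperplane H_φ. -/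
open scoped BigOperators
open MeasureTheory

section helpers
open scoped Pointwise ENNReal

variable {G : Type*} [NormedAddCommGroup G] [NormedSpace ℝ G] [FiniteDimensional ℝ G]
  [MeasureSpace G] [BorelSpace G] [(volume : Measure G).IsAddHaarMeasure]

lemma slice_le (A : Set (ℝ × G)) (hc : Convex ℝ A) (hs : ∀ p ∈ A, -p ∈ A) (t : ℝ) :
    volume (Prod.mk t ⁻¹' A) ≤
      ENNReal.ofReal (2 ^ Module.finrank ℝ G) * volume (Prod.mk (0 : ℝ) ⁻¹' A) := by
  rcases (Prod.mk t ⁻¹' A).eq_empty_or_nonempty with h | ⟨y, hy⟩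
  · simp [h]
  have hsub : Prod.mk t ⁻¹' A ⊆ y +ᵥ ((2 : ℝ) • (Prod.mk (0 : ℝ) ⁻¹' A)) := by
    intro x hx
    rw [Set.mem_vadd_set]
    refine ⟨x - y, ?_, by simp⟩
    rw [Set.mem_smul_set]
    refine ⟨(1 / 2 : ℝ) • (x - y), ?_, by rw [smul_smul]; norm_num⟩
    have := hc hx (hs _ hy) (a := 1 / 2) (b := 1 / 2) (by norm_num) (by norm_num) (by norm_num)
    have e : (1 / 2 : ℝ) • (t, x) + (1 / 2 : ℝ) • (-(t, y)) = ((0 : ℝ), (1 / 2 : ℝ) • (x - y)) := by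
      ext <;> simp [smul_sub, sub_eq_add_neg]
    rw [e] at this
    exact this
  refine (measure_mono hsub).trans ?_
  rw [measure_vadd, Measure.addHaar_smul_of_nonneg _ (by norm_num)]

lemma vol_le (A : Set (ℝ × G)) (hc : Convex ℝ A) (hs : ∀ p ∈ A, -p ∈ A) (T : ℝ)
    (hT : ∀ p ∈ A, |p.1| ≤ T) :
    volume A ≤ ENNReal.ofReal (2 ^ Module.finrank ℝ G) * volume (Prod.mk (0 : ℝ) ⁻¹' A)
      * ENNReal.ofReal (2 * T) := by
  set C := ENNReal.ofReal (2 ^ Module.finrank ℝ G) * volume (Prod.mk (0 : ℝ) ⁻¹' A) with hC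
  have h1 : volume A ≤ volume (interior A) := by
    have : A ⊆ interior A ∪ frontier A := by
      intro x hx
      by_cases h : x ∈ interior A
      · exact Or.inl h
      · exact Or.inr ⟨subset_closure hx, h⟩
    have : volume A ≤ volume (interior A) + volume (frontier A) :=
      (measure_mono this).trans (measure_union_le _ _)
    have h0 : volume (frontier A) = 0 := hc.addHaar_frontier ((volume : Measure ℝ).prod (volume : Measure G))
    rwa [h0, add_zero] at this
  refine h1.trans ?_
  rw [Measure.volume_eq_prod, Measure.prod_apply isOpen_interior.measurableSet]
  calc ∫⁻ t, volume (Prod.mk t ⁻¹' interior A) 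
      ≤ ∫⁻ t, (Set.Icc (-T) T).indicator (fun _ => C) t := by
        refine lintegral_mono fun t => ?_
        by_cases ht : t ∈ Set.Icc (-T) T
        · rw [Set.indicator_of_mem ht]
          exact (measure_mono (Set.preimage_mono interior_subset)).trans (slice_le A hc hs t)
        · have : Prod.mk t ⁻¹' interior A = ∅ := by
            ext x
            simp only [Set.mem_preimage, Set.mem_empty_iff_false, iff_false]
            intro hx
            exact ht (abs_le.1 (hT _ (interior_subset hx)))
          simp [this]
    _ = C * ENNReal.ofReal (2 * T) := by
        rw [lintegral_indicator measurableSet_Icc, lintegral_const, Measure.restrict_apply_univ,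
          Real.volume_Icc]
        ring_nf

lemma le_vol (A : Set (ℝ × G)) (hc : Convex ℝ A) (h0 : (0 : ℝ × G) ∈ A) (p : ℝ × G)
    (hp : p ∈ A) (hs : 0 < p.1) :
    ENNReal.ofReal ((1 / 2) ^ Module.finrank ℝ G) * volume (Prod.mk (0 : ℝ) ⁻¹' A)
      * ENNReal.ofReal (p.1 / 2) ≤ volume A := by
  set C := ENNReal.ofReal ((1 / 2) ^ Module.finrank ℝ G) * volume (Prod.mk (0 : ℝ) ⁻¹' A) with hC
  rw [← measure_toMeasurable (μ := volume) A, Measure.volume_eq_prod,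
    Measure.prod_apply (measurableSet_toMeasurable _ _)]
  calc C * ENNReal.ofReal (p.1 / 2) = ∫⁻ t, (Set.Icc 0 (p.1 / 2)).indicator (fun _ => C) t := by
        rw [lintegral_indicator measurableSet_Icc, lintegral_const, Measure.restrict_apply_univ,
          Real.volume_Icc, sub_zero]
    _ ≤ _ := by
        refine lintegral_mono fun t => ?_
        by_cases ht : t ∈ Set.Icc 0 (p.1 / 2)
        · rw [Set.indicator_of_mem ht]
          have hsub : ((t / p.1) • p.2) +ᵥ ((1 / 2 : ℝ) • (Prod.mk (0 : ℝ) ⁻¹' A)) ⊆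
              Prod.mk t ⁻¹' (toMeasurable ((volume : Measure ℝ).prod (volume : Measure G)) A) := by
            rintro _ ⟨_, ⟨a, ha, rfl⟩, rfl⟩
            refine subset_toMeasurable _ _ ?_
            have h1 : (2 * t / p.1) • p ∈ A := by
              refine hc.smul_mem_of_zero_mem h0 hp ⟨?_, ?_⟩
              · have := ht.1
                positivity
              · rw [div_le_one hs]
                linarith [ht.2]
            have := hc h1 ha (a := 1 / 2) (b := 1 / 2) (by norm_num) (by norm_num) (by norm_num)
            have e : (1 / 2 : ℝ) • ((2 * t / p.1) • p) + (1 / 2 : ℝ) • ((0 : ℝ), a)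
                = (t, (t / p.1) • p.2 + (1 / 2 : ℝ) • a) := by
              ext
              · simp; field_simp
              · simp only [Prod.snd_add, Prod.smul_snd, smul_smul]
                congr 2
                ring
            rw [e] at this
            exact this
          refine le_trans (le_of_eq ?_) (measure_mono hsub)
          rw [measure_vadd, Measure.addHaar_smul_of_nonneg _ (by norm_num)]
        · simp [ht]

end helpers

lemma exists_isom (d : ℕ) (u : EuclideanSpace ℝ (Fin (d + 1))) (hu : ‖u‖ = 1) :
    ∃ e : WithLp 2 (ℝ × EuclideanSpace ℝ (Fin d)) ≃ₗᵢ[ℝ] EuclideanSpace ℝ (Fin (d + 1)),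
      e (WithLp.toLp 2 (1, 0)) = u := by
  have key : ∀ {E : Type} [NormedAddCommGroup E] [InnerProductSpace ℝ E] [FiniteDimensional ℝ E]
      (w : E), ‖w‖ = 1 → Module.finrank ℝ E = d + 1 →
      ∃ b : OrthonormalBasis (Fin (d + 1)) ℝ E, b 0 = w := by
    intro E _ _ _ w hw hE
    obtain ⟨b, hb⟩ := Orthonormal.exists_orthonormalBasis_extension_of_card_eq (𝕜 := ℝ) (E := E)
      (ι := Fin (d + 1)) (by simpa using hE) (v := fun _ => w) (s := {0}) (by
        constructor
        · intro i; simpa using hw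
        · intro i j hij
          exact absurd (Subsingleton.elim i j) hij)
    exact ⟨b, hb 0 rfl⟩
  obtain ⟨b, hb⟩ := key u hu (by simp)
  obtain ⟨b', hb'⟩ := key (WithLp.toLp 2 ((1 : ℝ), (0 : EuclideanSpace ℝ (Fin d))))
    (by simp [WithLp.prod_norm_eq_of_L2]) (by
      rw [(WithLp.linearEquiv 2 ℝ (ℝ × EuclideanSpace ℝ (Fin d))).finrank_eq]
      simp [add_comm])
  refine ⟨b'.equiv b (Equiv.refl _), ?_⟩
  rw [← hb', OrthonormalBasis.equiv_apply_basis, ← hb]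
  rfl

/-- for a bounded centrally symmetric convex body `K` with nonempty interior
and a nonzero linear functional `φ` (identified with its Riesz representative), the
`(D-1)`-dimensional volume of the slice `K ∩ ker φ` is comparable to
`‖φ‖ · vol(K) / ‖φ‖_K` up to constants depending only on `D`. The `(D-1)`-dimensional
volume on the hyperplane is the `(D-1)`-dimensional Hausdorff measure. -/
theorem stmt5 (D : ℕ) (hD : 2 ≤ D) :
    ∃ c₁ c₂ : ℝ, 0 < c₁ ∧ 0 < c₂ ∧
      ∀ K : Set (EuclideanSpace ℝ (Fin D)),
        Bornology.IsBounded K → K = -K → Convex ℝ K → (interior K).Nonempty →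
      ∀ φ : EuclideanSpace ℝ (Fin D), φ ≠ 0 →
        c₁ * (‖φ‖ * (volume K).toReal /
            sSup {y : ℝ | ∃ v ∈ K, y = |∑ i, φ i * v i|}) ≤
          (μH[(D : ℝ) - 1] (K ∩ {v : EuclideanSpace ℝ (Fin D) | ∑ i, φ i * v i = 0})).toReal ∧
        (μH[(D : ℝ) - 1] (K ∩ {v : EuclideanSpace ℝ (Fin D) | ∑ i, φ i * v i = 0})).toReal ≤
          c₂ * (‖φ‖ * (volume K).toReal /
            sSup {y : ℝ | ∃ v ∈ K, y = |∑ i, φ i * v i|}) := by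
  obtain ⟨d, rfl⟩ : ∃ d, D = d + 1 := ⟨D - 1, by omega⟩
  have hH : (μH[(d : ℝ)] : Measure (EuclideanSpace ℝ (Fin d))).IsAddHaarMeasure := inferInstance
  set c := Measure.addHaarScalarFactor (μH[(d : ℝ)] : Measure (EuclideanSpace ℝ (Fin d))) volume
    with hcdef
  have hc0 : 0 < c := Measure.addHaarScalarFactor_pos_of_isAddHaarMeasure _ _
  have hcm : (μH[(d : ℝ)] : Measure (EuclideanSpace ℝ (Fin d))) = c • volume :=
    Measure.isAddLeftInvariant_eq_smul _ _
  have hc0' : (0 : ℝ) < c := by exact_mod_cast hc0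
  refine ⟨c / (2 * 2 ^ d), c * (4 * 2 ^ d), by positivity, by positivity, ?_⟩
  intro K hKb hKs hKc hKi φ hφ
  have hφ0 : 0 < ‖φ‖ := norm_pos_iff.2 hφ
  obtain ⟨e, he⟩ := exists_isom d (‖φ‖⁻¹ • φ) (by
    rw [norm_smul, norm_inv, norm_norm, inv_mul_cancel₀ hφ0.ne'])
  have hsum : ∀ v : EuclideanSpace ℝ (Fin (d + 1)), ∑ i, φ i * v i = inner ℝ φ v := by
    intro v
    simp [PiLp.inner_apply, mul_comm]
  have hin : ∀ p : ℝ × EuclideanSpace ℝ (Fin d),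
      inner ℝ φ (e (WithLp.toLp 2 p)) = ‖φ‖ * p.1 := by
    intro p
    have h1 : φ = ‖φ‖ • e (WithLp.toLp 2 (1, 0)) := by
      rw [he, smul_smul, mul_inv_cancel₀ hφ0.ne', one_smul]
    conv_lhs => rw [h1]
    rw [inner_smul_left, e.inner_map_map]
    simp [WithLp.prod_inner_apply]
  simp only [hsum]
  set A : Set (ℝ × EuclideanSpace ℝ (Fin d)) := {p | e (WithLp.toLp 2 p) ∈ K} with hA
  have hvol : volume A = volume K := by
    have h1 := (e.measurePreserving).measure_preimage_equiv (f := e.toHomeomorph.toMeasurableEquiv) K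
    have h2 := (WithLp.volume_preserving_symm_measurableEquiv_toLp_prod ℝ
      (EuclideanSpace ℝ (Fin d))).symm.measure_preimage_equiv (e ⁻¹' K)
    exact h2.trans h1
  have hsymK : ∀ v ∈ K, -v ∈ K := by
    intro v hv
    rw [hKs] at hv
    exact hv
  have hAc : Convex ℝ A :=
    hKc.linear_preimage (e.toLinearMap ∘ₗ (WithLp.linearEquiv 2 ℝ _).symm.toLinearMap)
  have hAs : ∀ p ∈ A, -p ∈ A := by
    intro p hp
    have := hsymK _ hp
    rw [← map_neg] at this
    exact this
  have hslice : K ∩ {v | inner ℝ φ v = 0} =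
      (fun x => e (WithLp.toLp 2 ((0 : ℝ), x))) '' (Prod.mk (0 : ℝ) ⁻¹' A) := by
    ext v
    constructor
    · rintro ⟨hv, hv0⟩
      have hv' : e (WithLp.toLp 2 (WithLp.ofLp (e.symm v))) = v := by simp
      have h0 : (WithLp.ofLp (e.symm v)).1 = 0 := by
        have := hin (WithLp.ofLp (e.symm v))
        rw [hv', hv0] at this
        rcases mul_eq_zero.1 this.symm with h | h
        · exact absurd h hφ0.ne'
        · exact h
      have h3 : ((0 : ℝ), (WithLp.ofLp (e.symm v)).2) = WithLp.ofLp (e.symm v) := by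
        rw [← h0]
      refine ⟨(WithLp.ofLp (e.symm v)).2, ?_, ?_⟩
      · change e (WithLp.toLp 2 ((0 : ℝ), (WithLp.ofLp (e.symm v)).2)) ∈ K
        rw [h3, hv']; exact hv
      · change e (WithLp.toLp 2 ((0 : ℝ), (WithLp.ofLp (e.symm v)).2)) = v
        rw [h3, hv']
    · rintro ⟨x, hx, rfl⟩
      exact ⟨hx, by simpa using hin (0, x)⟩
  have hiso : Isometry (fun x : EuclideanSpace ℝ (Fin d) => e (WithLp.toLp 2 ((0 : ℝ), x))) := by
    refine e.isometry.comp ?_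
    refine Isometry.of_dist_eq fun x y => ?_
    simp [WithLp.prod_dist_eq_of_L2, Real.sqrt_sq dist_nonneg]
  have hμ : μH[((d + 1 : ℕ) : ℝ) - 1] (K ∩ {v | inner ℝ φ v = 0}) =
      c * volume (Prod.mk (0 : ℝ) ⁻¹' A) := by
    have : ((d + 1 : ℕ) : ℝ) - 1 = d := by push_cast; ring
    rw [this, hslice, hiso.hausdorffMeasure_image (Or.inl (by positivity)), hcm]
    rfl
  rw [hμ]
  -- the supremum
  set S := {y : ℝ | ∃ v ∈ K, y = |inner ℝ φ v|} with hS
  have hSb : BddAbove S := by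
    obtain ⟨R, hR⟩ := hKb.exists_norm_le
    refine ⟨‖φ‖ * R, ?_⟩
    rintro _ ⟨v, hv, rfl⟩
    exact (abs_real_inner_le_norm _ _).trans (by gcongr; exact hR v hv)
  have hK0 : (0 : EuclideanSpace ℝ (Fin (d + 1))) ∈ interior K := by
    obtain ⟨v, hv⟩ := hKi
    have hv' : -v ∈ K := hsymK _ (interior_subset hv)
    have := hKc.combo_interior_self_mem_interior hv hv' (a := 1 / 2) (b := 1 / 2) (by norm_num)
      (by norm_num) (by norm_num)
    simpa using this
  have hA0 : (0 : ℝ × EuclideanSpace ℝ (Fin d)) ∈ A := by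
    change e (WithLp.toLp 2 0) ∈ K
    simpa using interior_subset hK0
  have hSpos : 0 < sSup S := by
    have hcont : Filter.Tendsto (fun r : ℝ => r • φ) (nhdsWithin 0 (Set.Ioi 0)) (nhds 0) := by
      have : Continuous (fun r : ℝ => r • φ) := by fun_prop
      simpa using (this.tendsto 0).mono_left nhdsWithin_le_nhds
    have h1 := hcont.eventually (isOpen_interior.mem_nhds hK0)
    obtain ⟨r, hr, hr0⟩ := (h1.and self_mem_nhdsWithin).exists
    have hr0 : 0 < r := hr0
    refine lt_of_lt_of_le ?_ (le_csSup hSb ⟨r • φ, interior_subset hr, rfl⟩)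
    rw [inner_smul_right, real_inner_self_eq_norm_sq]
    positivity
  set T := sSup S / ‖φ‖ with hT
  have hTpos : 0 < T := by positivity
  have hTb : ∀ p ∈ A, |p.1| ≤ T := by
    intro p hp
    rw [hT, le_div_iff₀ hφ0]
    have := le_csSup hSb ⟨_, hp, rfl⟩
    rw [hin, abs_mul, abs_of_pos hφ0] at this
    linarith
  obtain ⟨p, hp, hp1⟩ : ∃ p ∈ A, T / 2 ≤ p.1 := by
    obtain ⟨_, ⟨v, hv, rfl⟩, hlt⟩ := exists_lt_of_lt_csSup (s := S) (b := sSup S / 2)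
      ⟨_, 0, interior_subset hK0, rfl⟩ (by linarith)
    have hv' : e (WithLp.toLp 2 (WithLp.ofLp (e.symm v))) = v := by simp
    set q := WithLp.ofLp (e.symm v)
    have hq : q ∈ A := by change e _ ∈ K; rw [hv']; exact hv
    have h2 : T / 2 ≤ |q.1| := by
      rw [← hv', hin, abs_mul, abs_of_pos hφ0] at hlt
      rw [hT, div_div, div_le_iff₀ (by positivity)]
      linarith
    rcases le_abs'.1 h2 with h | h
    · exact ⟨-q, hAs q hq, by simp; linarith⟩
    · exact ⟨q, hq, h⟩
  have hup := vol_le A hAc hAs T hTb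
  have hlo := le_vol A hAc hA0 p hp (by linarith)
  rw [hvol] at hup hlo
  have hKfin : volume K ≠ ⊤ := hKb.measure_lt_top.ne
  have hpp : 0 < p.1 := by linarith
  set V := volume (Prod.mk (0 : ℝ) ⁻¹' A) with hV
  have hVfin : V ≠ ⊤ := by
    intro h
    rw [h, ENNReal.mul_top (by positivity), ENNReal.top_mul (by positivity)] at hlo
    exact hKfin (top_le_iff.1 hlo)
  have hdim : Module.finrank ℝ (EuclideanSpace ℝ (Fin d)) = d := by simp
  rw [hdim] at hup hlo
  have hup' := ENNReal.toReal_mono (by finiteness) hup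
  have hlo' := ENNReal.toReal_mono hKfin hlo
  rw [ENNReal.toReal_mul, ENNReal.toReal_mul, ENNReal.toReal_ofReal (by positivity),
    ENNReal.toReal_ofReal (by positivity)] at hup' hlo'
  have hVe : ‖φ‖ * (volume K).toReal / sSup S = (volume K).toReal / T := by
    rw [hT]; field_simp
  rw [hVe, ENNReal.toReal_mul]
  simp only [ENNReal.coe_toReal]
  have hV0 : 0 ≤ V.toReal := ENNReal.toReal_nonneg
  constructor
  · have : (volume K).toReal / T ≤ 2 ^ d * V.toReal * 2 := by
      rw [div_le_iff₀ hTpos]; linarith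
    calc c / (2 * 2 ^ d) * ((volume K).toReal / T) ≤ c / (2 * 2 ^ d) * (2 ^ d * V.toReal * 2) := by
          gcongr
      _ = c * V.toReal := by field_simp
  · have : V.toReal ≤ 4 * 2 ^ d * ((volume K).toReal / T) := by
      have h3 : (1 / 2) ^ d * V.toReal * (T / 4) ≤ (volume K).toReal := by
        refine le_trans ?_ hlo'
        exact mul_le_mul_of_nonneg_left (by linarith) (by positivity)
      rw [← mul_div_assoc, le_div_iff₀ hTpos]
      rw [div_pow, one_pow] at h3
      have h2 : (0 : ℝ) < 2 ^ d := by positivity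
      calc V.toReal * T = 4 * 2 ^ d * (1 / 2 ^ d * V.toReal * (T / 4)) := by field_simp
        _ ≤ _ := by gcongr
    calc (c : ℝ) * V.toReal ≤ c * (4 * 2 ^ d * ((volume K).toReal / T)) := by gcongr
      _ = _ := by ring
end
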